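/- arXiv:0811.4765 — 6 statements merged into one kernel-verified Lean document; each statement's English description precedes it below -/
import Mathlib

section
/- Let K be a real 2n×2n matrix with Kᵀ = -K and J₀K = -KJ₀. Then the matrix J₀K is skew-symmetric ((J₀K)ᵀ = -J₀K), the matrix I + J₀K is invertible, and the matrix J_K := (I + J₀K)⁻¹ J₀ (I + J₀K) satisfies J_K² = -I and J_Kᵀ J_K = I; equivalently, ⟨J_K x, J_K y⟩ = ⟨x, y⟩ for all x, y ∈ ℝ^{2n}. -/
/- STATEMENT 5: Let `K` be a real `2n × 2n` matrix with `Kᵀ = -K` and `J₀ K = -K J₀`.  Then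
`J₀ K` is skew-symmetric, `I + J₀ K` is invertible, and
`J_K := (I + J₀ K)⁻¹ J₀ (I + J₀ K)` satisfies `J_K² = -I` and `J_Kᵀ J_K = I`; equivalently
`⟨J_K x, J_K y⟩ = ⟨x, y⟩` for all `x, y ∈ ℝ^{2n}`. -/

open Matrix

/-- The standard complex structure `J₀` on `ℝ^{2n}`, as the block matrix `[[0, -I], [I, 0]]`. -/
noncomputable def stdJ (n : ℕ) : Matrix (Fin n ⊕ Fin n) (Fin n ⊕ Fin n) ℝ :=
  Matrix.fromBlocks 0 (-1) 1 0

theorem stdJ_eq_J (n : ℕ) : stdJ n = Matrix.J (Fin n) ℝ := rfl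

theorem isUnit_one_add_of_transpose_eq_neg {ι : Type*} [Fintype ι] [DecidableEq ι]
    {S : Matrix ι ι ℝ} (hS : Sᵀ = -S) : IsUnit (1 + S) := by
  rw [← mulVec_injective_iff_isUnit, ← coe_mulVecLin, ← LinearMap.ker_eq_bot,
    LinearMap.ker_eq_bot']
  intro v hv
  have hv' : v + S *ᵥ v = 0 := by simpa [add_mulVec] using hv
  have hskew : v ⬝ᵥ S *ᵥ v = -(v ⬝ᵥ S *ᵥ v) := by
    conv_lhs => rw [dotProduct_mulVec, ← mulVec_transpose, hS, neg_mulVec, neg_dotProduct,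
      dotProduct_comm]
  have hsum : v ⬝ᵥ v + v ⬝ᵥ S *ᵥ v = 0 := by rw [← dotProduct_add, hv', dotProduct_zero]
  exact dotProduct_self_eq_zero.mp (by linarith)

/-- If `J` and `S` are skew-symmetric and anticommute, then conjugating `J` by `1 + S` gives a
skew-symmetric matrix. -/
theorem transpose_conj_one_add_eq_neg {ι : Type*} [Fintype ι] [DecidableEq ι]
    {J S : Matrix ι ι ℝ} (hJ : Jᵀ = -J) (hS : Sᵀ = -S) (hJS : J * S = -(S * J)) :
    ((1 + S)⁻¹ * J * (1 + S))ᵀ = -((1 + S)⁻¹ * J * (1 + S)) := by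
  have hA : IsUnit (1 + S) := isUnit_one_add_of_transpose_eq_neg hS
  have hT : (1 + S)ᵀ = 1 - S := by rw [transpose_add, transpose_one, hS, sub_eq_add_neg]
  have hB : IsUnit (1 - S) := hT ▸ (isUnit_transpose _).mpr hA
  have hAdet := (isUnit_iff_isUnit_det _).mp hA
  have hBdet := (isUnit_iff_isUnit_det _).mp hB
  apply hA.mul_left_cancel
  apply hB.mul_right_cancel
  have hcomm : J * ((1 + S) * (1 - S)) = (1 + S) * (1 - S) * J := by
    have hJSS : J * (S * S) = S * S * J := by
      rw [← mul_assoc, hJS, neg_mul, mul_assoc, hJS, mul_neg, neg_neg, mul_assoc]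
    have hprod : (1 + S) * (1 - S) = 1 - S * S := by noncomm_ring
    rw [hprod, mul_sub, sub_mul, hJSS, mul_one, one_mul]
  calc (1 + S) * ((1 + S)⁻¹ * J * (1 + S))ᵀ * (1 - S)
      = -((1 + S) * (1 - S) * J) := by
        rw [transpose_mul, transpose_mul, transpose_nonsing_inv, hT, hJ]
        simp only [neg_mul, mul_neg, mul_assoc, nonsing_inv_mul _ hBdet, mul_one]
    _ = (1 + S) * -((1 + S)⁻¹ * J * (1 + S)) * (1 - S) := by
        rw [← hcomm]
        simp only [neg_mul, mul_neg, mul_assoc, mul_nonsing_inv_cancel_left _ _ hAdet]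

theorem statement5 (n : ℕ) (K : Matrix (Fin n ⊕ Fin n) (Fin n ⊕ Fin n) ℝ)
    (hskew : Kᵀ = -K) (hanti : stdJ n * K = -(K * stdJ n)) :
    (stdJ n * K)ᵀ = -(stdJ n * K) ∧
    IsUnit (1 + stdJ n * K) ∧
    ((1 + stdJ n * K)⁻¹ * stdJ n * (1 + stdJ n * K)) *
      ((1 + stdJ n * K)⁻¹ * stdJ n * (1 + stdJ n * K)) = -1 ∧
    ((1 + stdJ n * K)⁻¹ * stdJ n * (1 + stdJ n * K))ᵀ *
      ((1 + stdJ n * K)⁻¹ * stdJ n * (1 + stdJ n * K)) = 1 ∧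
    ∀ x y : Fin n ⊕ Fin n → ℝ,
      ((((1 + stdJ n * K)⁻¹ * stdJ n * (1 + stdJ n * K)) *ᵥ x) ⬝ᵥ
        (((1 + stdJ n * K)⁻¹ * stdJ n * (1 + stdJ n * K)) *ᵥ y)) = x ⬝ᵥ y := by
  have hJT : (stdJ n)ᵀ = -stdJ n := by rw [stdJ_eq_J, J_transpose]
  have hJJ : stdJ n * stdJ n = -1 := by rw [stdJ_eq_J, J_squared]
  have hS : (stdJ n * K)ᵀ = -(stdJ n * K) := by
    rw [transpose_mul, hskew, hJT, neg_mul_neg, hanti, neg_neg]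
  have hJS : stdJ n * (stdJ n * K) = -(stdJ n * K * stdJ n) := by
    rw [mul_assoc, ← mul_neg, ← hanti]
  have hA := isUnit_one_add_of_transpose_eq_neg hS
  have hAdet := (isUnit_iff_isUnit_det _).mp hA
  have hM := transpose_conj_one_add_eq_neg hJT hS hJS
  have hsq : ((1 + stdJ n * K)⁻¹ * stdJ n * (1 + stdJ n * K)) *
      ((1 + stdJ n * K)⁻¹ * stdJ n * (1 + stdJ n * K)) = -1 := by
    generalize 1 + stdJ n * K = A at hAdet ⊢
    calc A⁻¹ * stdJ n * A * (A⁻¹ * stdJ n * A)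
        = A⁻¹ * (stdJ n * stdJ n) * A := by
          simp only [mul_assoc, mul_nonsing_inv_cancel_left _ _ hAdet]
      _ = -1 := by rw [hJJ, mul_neg, mul_one, neg_mul, nonsing_inv_mul _ hAdet]
  have horth : ((1 + stdJ n * K)⁻¹ * stdJ n * (1 + stdJ n * K))ᵀ *
      ((1 + stdJ n * K)⁻¹ * stdJ n * (1 + stdJ n * K)) = 1 := by
    rw [hM, neg_mul, hsq, neg_neg]
  refine ⟨hS, hA, hsq, horth, fun x y => ?_⟩
  rw [dotProduct_mulVec, ← mulVec_transpose, mulVec_mulVec, horth, one_mulVec]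
end

section
/- For all real numbers a, b, the matrix I + J₀K_{a,b} is invertible and the matrix J_{a,b} := (I + J₀K_{a,b})⁻¹ J₀ (I + J₀K_{a,b}) equals ((1 - (a²+b²))·J₀ - 2·K_{a,b}) / (1 + a² + b²); explicitly, J_{a,b} = (1/(1 + a² + b²)) times the matrix with rows [[0, -1+(a²+b²), -2a, -2b],[1-(a²+b²), 0, -2b, 2a],[2a, 2b, 0, -1+(a²+b²)],[2b, -2a, 1-(a²+b²), 0]]. Moreover J_{a,b}² = -I. -/
/- STATEMENT 7: For all real `a, b`, the matrix `I + J₀ K_{a,b}` is invertible and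
`J_{a,b} := (I + J₀ K_{a,b})⁻¹ J₀ (I + J₀ K_{a,b})` equals
`((1 - (a² + b²)) J₀ - 2 K_{a,b}) / (1 + a² + b²)`, given explicitly by the matrix below.
Moreover `J_{a,b}² = -I`. -/

open Matrix

/-- The standard complex structure `J₀` on `ℝ⁴` with `J₀ e₁ = e₂`, `J₀ e₃ = e₄`. -/
noncomputable def J4 : Matrix (Fin 4) (Fin 4) ℝ :=
  !![0, -1, 0, 0; 1, 0, 0, 0; 0, 0, 0, -1; 0, 0, 1, 0]

/-- The endomorphism `K_{a,b}` associated to the form `a (e¹³ - e²⁴) + b (e¹⁴ + e²³)`. -/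
noncomputable def Kab (a b : ℝ) : Matrix (Fin 4) (Fin 4) ℝ :=
  !![0, 0, a, b; 0, 0, b, -a; -a, -b, 0, 0; -b, a, 0, 0]

theorem J4_mul_self : J4 * J4 = -1 := by
  ext i j
  fin_cases i <;> fin_cases j <;> simp [J4, Matrix.mul_apply, Fin.sum_univ_four]

theorem Kab_mul_J4 (a b : ℝ) : Kab a b * J4 = -(J4 * Kab a b) := by
  ext i j
  fin_cases i <;> fin_cases j <;> simp [J4, Kab, Matrix.mul_apply, Fin.sum_univ_four]

theorem Kab_mul_self (a b : ℝ) : Kab a b * Kab a b = -(a ^ 2 + b ^ 2) • 1 := by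
  ext i j
  fin_cases i <;> fin_cases j <;> simp [Kab, Matrix.mul_apply, Fin.sum_univ_four] <;> ring

theorem one_add_mul_one_sub (a b : ℝ) :
    (1 + J4 * Kab a b) * (1 - J4 * Kab a b) = (1 + a ^ 2 + b ^ 2) • 1 := by
  have h : J4 * Kab a b * (J4 * Kab a b) = -(a ^ 2 + b ^ 2) • 1 := by
    rw [← Kab_mul_self, mul_assoc, ← mul_assoc (Kab a b), Kab_mul_J4, neg_mul, mul_neg,
      mul_assoc J4 (Kab a b), ← mul_assoc J4 J4, J4_mul_self, neg_one_mul, neg_neg]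
  have e : (1 + J4 * Kab a b) * (1 - J4 * Kab a b) =
      1 - J4 * Kab a b * (J4 * Kab a b) := by noncomm_ring
  rw [e, h]
  module

theorem J4_mul_one_add (a b : ℝ) :
    J4 * (1 + J4 * Kab a b) =
      (1 + J4 * Kab a b) * ((1 / (1 + a ^ 2 + b ^ 2)) •
        ((1 - (a ^ 2 + b ^ 2)) • J4 - (2 : ℝ) • Kab a b)) := by
  have hr : 1 + a ^ 2 + b ^ 2 ≠ 0 := by positivity
  have h₁ : J4 * (J4 * Kab a b) = -Kab a b := by
    rw [← mul_assoc, J4_mul_self, neg_one_mul]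
  have h₂ : J4 * Kab a b * J4 = Kab a b := by
    rw [mul_assoc, Kab_mul_J4, mul_neg, h₁, neg_neg]
  have h₃ : J4 * Kab a b * Kab a b = -(a ^ 2 + b ^ 2) • J4 := by
    rw [mul_assoc, Kab_mul_self, mul_smul_comm, mul_one]
  rw [mul_smul_comm, mul_sub, mul_smul_comm, mul_smul_comm, add_mul, add_mul, one_mul, one_mul,
    h₂, h₃, mul_add, mul_one, h₁, one_div, eq_inv_smul_iff₀ hr]
  module

theorem statement7 (a b : ℝ) :
    IsUnit (1 + J4 * Kab a b) ∧
    (1 + J4 * Kab a b)⁻¹ * J4 * (1 + J4 * Kab a b) =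
      (1 / (1 + a ^ 2 + b ^ 2)) • ((1 - (a ^ 2 + b ^ 2)) • J4 - (2 : ℝ) • Kab a b) ∧
    (1 + J4 * Kab a b)⁻¹ * J4 * (1 + J4 * Kab a b) =
      (1 / (1 + a ^ 2 + b ^ 2)) •
        !![0, -1 + (a ^ 2 + b ^ 2), -2 * a, -2 * b;
           1 - (a ^ 2 + b ^ 2), 0, -2 * b, 2 * a;
           2 * a, 2 * b, 0, -1 + (a ^ 2 + b ^ 2);
           2 * b, -2 * a, 1 - (a ^ 2 + b ^ 2), 0] ∧
    ((1 + J4 * Kab a b)⁻¹ * J4 * (1 + J4 * Kab a b)) *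
      ((1 + J4 * Kab a b)⁻¹ * J4 * (1 + J4 * Kab a b)) = -1 := by
  have hr : 1 + a ^ 2 + b ^ 2 ≠ 0 := by positivity
  have hu : IsUnit (1 + J4 * Kab a b) := by
    refine (isUnit_iff_isUnit_det _).2 (isUnit_det_of_right_inverse
      (B := (1 + a ^ 2 + b ^ 2)⁻¹ • (1 - J4 * Kab a b)) ?_)
    rw [mul_smul_comm, one_add_mul_one_sub, inv_smul_smul₀ hr]
  have hdet := (isUnit_iff_isUnit_det _).1 hu
  have hJ : (1 + J4 * Kab a b)⁻¹ * J4 * (1 + J4 * Kab a b) =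
      (1 / (1 + a ^ 2 + b ^ 2)) • ((1 - (a ^ 2 + b ^ 2)) • J4 - (2 : ℝ) • Kab a b) := by
    rw [mul_assoc, J4_mul_one_add, nonsing_inv_mul_cancel_left _ _ hdet]
  refine ⟨hu, hJ, hJ.trans ?_, ?_⟩
  · congr 1
    ext i j
    fin_cases i <;> fin_cases j <;> simp [J4, Kab] <;> ring
  · rw [mul_assoc _ (1 + J4 * Kab a b), mul_assoc _ J4, mul_assoc _ J4,
      mul_nonsing_inv_cancel_left _ _ hdet, ← mul_assoc J4 J4, J4_mul_self, neg_one_mul, mul_neg,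
      nonsing_inv_mul _ hdet]
end

section
/- For all real numbers a, b, the almost complex structure J_{a,b} := (I + J₀K_{a,b})⁻¹ J₀ (I + J₀K_{a,b}) is tamed by ω, i.e. ω(v, J_{a,b}v) > 0 for every nonzero v ∈ ℝ⁴, if and only if a² + b² < 1. -/
/- STATEMENT 8: For all real `a, b`, the almost complex structure
`J_{a,b} := (I + J₀ K_{a,b})⁻¹ J₀ (I + J₀ K_{a,b})` is tamed by `ω` (i.e. `ω(v, J_{a,b} v) > 0`
for every nonzero `v ∈ ℝ⁴`) if and only if `a² + b² < 1`. -/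

open Matrix

/-- The symplectic form `ω(u, v) = g(J₀ u, v)`, `g` the Euclidean inner product. -/
noncomputable def omega4 (u v : Fin 4 → ℝ) : ℝ :=
  (J4 *ᵥ u) ⬝ᵥ v

lemma inv_one_add_J4_mul_Kab (a b : ℝ) :
    (1 + J4 * Kab a b)⁻¹ = (1 + (a ^ 2 + b ^ 2))⁻¹ • (1 - J4 * Kab a b) := by
  have hr : 1 + (a ^ 2 + b ^ 2) ≠ 0 := by positivity
  have hmul : (1 + J4 * Kab a b) * (1 - J4 * Kab a b) =
      (1 + (a ^ 2 + b ^ 2)) • (1 : Matrix (Fin 4) (Fin 4) ℝ) := by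
    ext i j
    fin_cases i <;> fin_cases j <;>
      simp [J4, Kab, Matrix.mul_apply, Fin.sum_univ_four, Matrix.one_apply] <;> ring
  apply Matrix.inv_eq_right_inv
  rw [Matrix.mul_smul, hmul, smul_smul, inv_mul_cancel₀ hr, one_smul]

lemma omega4_conj_J4 (a b : ℝ) (v : Fin 4 → ℝ) :
    omega4 v (((1 + J4 * Kab a b)⁻¹ * J4 * (1 + J4 * Kab a b)) *ᵥ v) =
      (1 + (a ^ 2 + b ^ 2))⁻¹ * (1 - (a ^ 2 + b ^ 2)) * (v ⬝ᵥ v) := by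
  have hconj : (1 - J4 * Kab a b) * J4 * (1 + J4 * Kab a b) =
      !![0, -(1 - (a ^ 2 + b ^ 2)), -2 * a, -2 * b;
        1 - (a ^ 2 + b ^ 2), 0, -2 * b, 2 * a;
        2 * a, 2 * b, 0, -(1 - (a ^ 2 + b ^ 2));
        2 * b, -2 * a, 1 - (a ^ 2 + b ^ 2), 0] := by
    ext i j
    fin_cases i <;> fin_cases j <;>
      simp [J4, Kab, Matrix.mul_apply, Fin.sum_univ_four, Matrix.one_apply] <;> ring
  rw [inv_one_add_J4_mul_Kab, Matrix.smul_mul, Matrix.smul_mul, hconj, Matrix.smul_mulVec,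
    omega4, dotProduct_smul, smul_eq_mul, mul_assoc]
  congr 1
  simp [J4, Matrix.mulVec, dotProduct, Fin.sum_univ_four]
  ring

theorem statement8 (a b : ℝ) :
    (∀ v : Fin 4 → ℝ, v ≠ 0 →
        0 < omega4 v (((1 + J4 * Kab a b)⁻¹ * J4 * (1 + J4 * Kab a b)) *ᵥ v)) ↔
      a ^ 2 + b ^ 2 < 1 := by
  have hr : 0 < (1 + (a ^ 2 + b ^ 2))⁻¹ := by positivity
  simp only [omega4_conj_J4]
  constructor
  · intro h
    have h1 := h (Pi.single 0 1) (by simp)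
    simp only [dotProduct_single, Pi.single_eq_same, mul_one] at h1
    linarith [(mul_pos_iff_of_pos_left hr).mp h1]
  · intro h v hv
    have hvv : 0 < v ⬝ᵥ v :=
      lt_of_le_of_ne (Finset.sum_nonneg fun i _ => mul_self_nonneg (v i))
        (Ne.symm (mt dotProduct_self_eq_zero.mp hv))
    exact mul_pos (mul_pos hr (by linarith)) hvv
end

section
/- On the 3-step nilpotent Lie algebra 𝔫, the 2-form ω = e^{13} + e^{24} is closed and nondegenerate, yet the Hard Lefschetz property fails at the level of invariant forms: for every closed 1-form β ∈ 𝔫* (i.e. β([x,y]) = 0 for all x, y), the 3-form β ∧ ω is exact, i.e. there exists a 2-form γ ∈ Λ²𝔫* with dγ = β ∧ ω. (Concretely, e¹ ∧ ω = d(e^{23}) and e² ∧ ω = d(e^{34}).) -/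
/- STATEMENT 13: On the 3-step nilpotent Lie algebra `𝔫` (basis `e₁, …, e₄`, nonzero brackets
`[e₁,e₂] = -e₄`, `[e₁,e₄] = -e₃`), the 2-form `ω = e¹³ + e²⁴` is closed and nondegenerate,
yet Hard Lefschetz fails at the invariant level: for every closed 1-form `β`, the 3-form
`β ∧ ω` is exact, i.e. `β ∧ ω = dγ` for some 2-form `γ`.
(Concretely, `e¹ ∧ ω = d(e²³)` and `e² ∧ ω = d(e³⁴)`.) -/

/-- The basis vectors `e₁, …, e₄` of `𝔫` (zero-indexed). -/
noncomputable def e (i : Fin 4) : Fin 4 → ℝ := Pi.single i 1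

/-- The Lie bracket of `𝔫`: `[e₁,e₂] = -e₄`, `[e₁,e₄] = -e₃`. -/
noncomputable def bracket (u v : Fin 4 → ℝ) : Fin 4 → ℝ :=
  -((u 0 * v 3 - v 0 * u 3) • e 2) - (u 0 * v 1 - v 0 * u 1) • e 3

/-- The 2-form `e^{ij} = eⁱ ∧ eʲ` (zero-indexed), as a bilinear form on `𝔫`. -/
noncomputable def eForm (i j : Fin 4) : (Fin 4 → ℝ) →ₗ[ℝ] (Fin 4 → ℝ) →ₗ[ℝ] ℝ :=
  (LinearMap.proj (R := ℝ) (φ := fun _ : Fin 4 => ℝ) i).smulRight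
      (LinearMap.proj (R := ℝ) (φ := fun _ : Fin 4 => ℝ) j) -
    (LinearMap.proj (R := ℝ) (φ := fun _ : Fin 4 => ℝ) j).smulRight
      (LinearMap.proj (R := ℝ) (φ := fun _ : Fin 4 => ℝ) i)

/-- The symplectic form `ω = e¹³ + e²⁴` on `𝔫`. -/
noncomputable def omegaN : (Fin 4 → ℝ) →ₗ[ℝ] (Fin 4 → ℝ) →ₗ[ℝ] ℝ :=
  eForm 0 2 + eForm 1 3

/-- A 2-form `α` is closed when its Chevalley-Eilenberg differential
`(dα)(x,y,z) = -α([x,y],z) + α([x,z],y) - α([y,z],x)` vanishes. -/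
def IsClosed2 (α : (Fin 4 → ℝ) →ₗ[ℝ] (Fin 4 → ℝ) →ₗ[ℝ] ℝ) : Prop :=
  ∀ x y z : Fin 4 → ℝ,
    -α (bracket x y) z + α (bracket x z) y - α (bracket y z) x = 0

theorem eForm_apply (i j : Fin 4) (u v : Fin 4 → ℝ) :
    eForm i j u v = u i * v j - u j * v i := by
  simp [eForm]

theorem omegaN_apply (u v : Fin 4 → ℝ) :
    omegaN u v = (u 0 * v 2 - u 2 * v 0) + (u 1 * v 3 - u 3 * v 1) := by
  simp [omegaN, eForm_apply]

theorem bracket_eq (u v : Fin 4 → ℝ) :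
    bracket u v = ![0, 0, -(u 0 * v 3 - v 0 * u 3), -(u 0 * v 1 - v 0 * u 1)] := by
  ext i
  fin_cases i <;> simp [bracket, e]

theorem isClosed2_omegaN : IsClosed2 omegaN := by
  intro x y z
  simp [omegaN_apply, bracket_eq]
  ring

theorem omegaN_nondegenerate (v : Fin 4 → ℝ) (h : ∀ w, omegaN v w = 0) : v = 0 := by
  have h0 := h (e 0)
  have h1 := h (e 1)
  have h2 := h (e 2)
  have h3 := h (e 3)
  simp [omegaN_apply, e] at h0 h1 h2 h3
  ext i
  fin_cases i <;> simp [h0, h1, h2, h3]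

/-- `d(e²³) = e¹ ∧ ω`. -/
theorem d_eForm_one_two (x y z : Fin 4 → ℝ) :
    -eForm 1 2 (bracket x y) z + eForm 1 2 (bracket x z) y - eForm 1 2 (bracket y z) x =
      x 0 * omegaN y z - y 0 * omegaN x z + z 0 * omegaN x y := by
  simp [omegaN_apply, eForm_apply, bracket_eq]
  ring

/-- `d(e³⁴) = e² ∧ ω`. -/
theorem d_eForm_two_three (x y z : Fin 4 → ℝ) :
    -eForm 2 3 (bracket x y) z + eForm 2 3 (bracket x z) y - eForm 2 3 (bracket y z) x =
      x 1 * omegaN y z - y 1 * omegaN x z + z 1 * omegaN x y := by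
  simp [omegaN_apply, eForm_apply, bracket_eq]
  ring

/-- A closed 1-form on `𝔫` is a combination of `e¹` and `e²`. -/
theorem closed_oneForm_apply (β : (Fin 4 → ℝ) →ₗ[ℝ] ℝ)
    (h : ∀ x y, β (bracket x y) = 0) (x : Fin 4 → ℝ) :
    β x = β (e 0) * x 0 + β (e 1) * x 1 := by
  have h2 : β (e 2) = 0 := by simpa [bracket, e] using h (e 0) (e 3)
  have h3 : β (e 3) = 0 := by simpa [bracket, e] using h (e 0) (e 1)
  have hx : x = x 0 • e 0 + x 1 • e 1 + x 2 • e 2 + x 3 • e 3 := by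
    ext i
    fin_cases i <;> simp [e]
  conv_lhs => rw [hx]
  simp only [map_add, map_smul, h2, h3, smul_eq_mul]
  ring

theorem statement13 :
    -- `ω` is closed
    IsClosed2 omegaN ∧
    -- `ω` is nondegenerate
    (∀ v : Fin 4 → ℝ, (∀ w : Fin 4 → ℝ, omegaN v w = 0) → v = 0) ∧
    -- for every closed 1-form `β`, the 3-form `β ∧ ω` is exact:
    -- there is an alternating 2-form `γ` with `dγ = β ∧ ω`
    (∀ β : (Fin 4 → ℝ) →ₗ[ℝ] ℝ, (∀ x y : Fin 4 → ℝ, β (bracket x y) = 0) →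
      ∃ γ : (Fin 4 → ℝ) →ₗ[ℝ] (Fin 4 → ℝ) →ₗ[ℝ] ℝ, (∀ x, γ x x = 0) ∧
        ∀ x y z : Fin 4 → ℝ,
          -γ (bracket x y) z + γ (bracket x z) y - γ (bracket y z) x =
            β x * omegaN y z - β y * omegaN x z + β z * omegaN x y) ∧
    -- concretely, `e¹ ∧ ω = d(e²³)`
    (∀ x y z : Fin 4 → ℝ,
      -eForm 1 2 (bracket x y) z + eForm 1 2 (bracket x z) y - eForm 1 2 (bracket y z) x =
        x 0 * omegaN y z - y 0 * omegaN x z + z 0 * omegaN x y) ∧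
    -- and `e² ∧ ω = d(e³⁴)`
    (∀ x y z : Fin 4 → ℝ,
      -eForm 2 3 (bracket x y) z + eForm 2 3 (bracket x z) y - eForm 2 3 (bracket y z) x =
        x 1 * omegaN y z - y 1 * omegaN x z + z 1 * omegaN x y) := by
  refine ⟨isClosed2_omegaN, omegaN_nondegenerate, fun β hβ => ?_, d_eForm_one_two,
    d_eForm_two_three⟩
  refine ⟨β (e 0) • eForm 1 2 + β (e 1) • eForm 2 3, fun x => ?_, fun x y z => ?_⟩
  · simp only [LinearMap.add_apply, LinearMap.smul_apply, eForm_apply, smul_eq_mul]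
    ring
  · rw [closed_oneForm_apply β hβ x, closed_oneForm_apply β hβ y, closed_oneForm_apply β hβ z]
    simp only [LinearMap.add_apply, LinearMap.smul_apply, smul_eq_mul]
    linear_combination β (e 0) * d_eForm_one_two x y z + β (e 1) * d_eForm_two_three x y z
end

section
/- On the 3-step nilpotent Lie algebra 𝔫, let J̃₀ be the complex structure with J̃₀e₁ = e₂, J̃₀e₂ = -e₁, J̃₀e₃ = e₄, J̃₀e₄ = -e₃. Then every 2-form ω̃ ∈ Λ²𝔫* that is closed (dω̃ = 0) and J̃₀-invariant (ω̃(J̃₀x, J̃₀y) = ω̃(x,y) for all x, y) satisfies ω̃(e₃, e₄) = 0. In particular, there exists no closed J̃₀-invariant 2-form ω̃ on 𝔫 with ω̃(x, J̃₀x) > 0 for all x ≠ 0, i.e. no invariant symplectic form on 𝔫 calibrates J̃₀. -/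
/-- The complex structure `J̃₀` with `J̃₀e₁ = e₂`, `J̃₀e₂ = -e₁`, `J̃₀e₃ = e₄`,
`J̃₀e₄ = -e₃`. -/
noncomputable def Jtilde (x : Fin 4 → ℝ) : Fin 4 → ℝ :=
  ![-(x 1), x 0, -(x 3), x 2]

theorem bracket_e_zero_one : bracket (e 0) (e 1) = -e 3 := by
  simp [bracket, e]

theorem bracket_e_zero_two : bracket (e 0) (e 2) = 0 := by
  simp [bracket, e]

theorem bracket_e_one_two : bracket (e 1) (e 2) = 0 := by
  simp [bracket, e]

theorem Jtilde_e_two : Jtilde (e 2) = e 3 := by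
  ext i
  fin_cases i <;> simp [Jtilde, e]

/-- A closed 2-form vanishes on `(e₃, e₄)`; invariance under `J̃₀` is not needed. -/
theorem IsClosed2.apply_e_two_e_three {ω : (Fin 4 → ℝ) →ₗ[ℝ] (Fin 4 → ℝ) →ₗ[ℝ] ℝ}
    (hω : IsClosed2 ω) (halt : ω.IsAlt) : ω (e 2) (e 3) = 0 := by
  have h := hω (e 0) (e 1) (e 2)
  rw [bracket_e_zero_one, bracket_e_zero_two, bracket_e_one_two] at h
  rw [← halt.neg]
  simpa using h

theorem statement14 :
    (∀ ω : (Fin 4 → ℝ) →ₗ[ℝ] (Fin 4 → ℝ) →ₗ[ℝ] ℝ, (∀ x, ω x x = 0) →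
      IsClosed2 ω → (∀ x y : Fin 4 → ℝ, ω (Jtilde x) (Jtilde y) = ω x y) →
      ω (e 2) (e 3) = 0) ∧
    ¬ ∃ ω : (Fin 4 → ℝ) →ₗ[ℝ] (Fin 4 → ℝ) →ₗ[ℝ] ℝ, (∀ x, ω x x = 0) ∧
        IsClosed2 ω ∧ (∀ x y : Fin 4 → ℝ, ω (Jtilde x) (Jtilde y) = ω x y) ∧
        ∀ x : Fin 4 → ℝ, x ≠ 0 → 0 < ω x (Jtilde x) := by
  refine ⟨fun ω halt hω _ => hω.apply_e_two_e_three halt, ?_⟩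
  rintro ⟨ω, halt, hω, -, hpos⟩
  have h := hpos (e 2) (by simp [e])
  rw [Jtilde_e_two, hω.apply_e_two_e_three halt] at h
  exact lt_irrefl 0 h
end

section
/- Let t, a ∈ ℝ satisfy 4t²a² < 1 and let L_t be the 4×4 matrix with rows [[0,0,ta,0],[0,0,0,-ta],[ta,0,0,0],[0,-ta,0,0]]. Then I + L_t is invertible and the matrix J_t := (I + L_t) J₀ (I + L_t)⁻¹ equals (1/(t²a² - 1)) times the matrix with rows [[0, 1+t²a², 0, 2ta],[-(1+t²a²), 0, 2ta, 0],[0, 2ta, 0, 1+t²a²],[2ta, 0, -(1+t²a²), 0]]. Moreover J_t² = -I and J_t is calibrated by ω: ω(J_t u, J_t v) = ω(u,v) for all u, v ∈ ℝ⁴ and ω(v, J_t v) > 0 for every nonzero v ∈ ℝ⁴. -/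
/- STATEMENT 16: Let `t, a ∈ ℝ` with `4 t² a² < 1` and let `L_t` be the matrix with rows
`[[0,0,ta,0],[0,0,0,-ta],[ta,0,0,0],[0,-ta,0,0]]`.  Then `I + L_t` is invertible,
`J_t := (I + L_t) J₀ (I + L_t)⁻¹` equals `(1/(t²a² - 1))` times the matrix
`[[0, 1+t²a², 0, 2ta],[-(1+t²a²), 0, 2ta, 0],[0, 2ta, 0, 1+t²a²],[2ta, 0, -(1+t²a²), 0]]`,
`J_t² = -I`, and `J_t` is calibrated by `ω = e¹² + e³⁴`. -/

open Matrix

/-- The deformation matrix `L_t` (depending on the parameters `t, a`). -/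
noncomputable def Lta (t a : ℝ) : Matrix (Fin 4) (Fin 4) ℝ :=
  !![0, 0, t * a, 0; 0, 0, 0, -(t * a); t * a, 0, 0, 0; 0, -(t * a), 0, 0]

/-- The matrix `(1 - t²a²)⁻¹ • (1 - L_t)` is a right inverse of `1 + L_t`. -/
lemma one_add_Lta_mul_inverse (t a : ℝ) (hne : t ^ 2 * a ^ 2 - 1 ≠ 0) :
    (1 + Lta t a) * ((1 / (1 - t ^ 2 * a ^ 2)) • (1 - Lta t a)) = 1 := by
  have hsq : Lta t a * Lta t a = (t ^ 2 * a ^ 2) • (1 : Matrix (Fin 4) (Fin 4) ℝ) := by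
    ext i j
    fin_cases i <;> fin_cases j <;>
      simp [Lta, Matrix.mul_apply, Fin.sum_univ_four] <;> ring
  have hne' : 1 - t ^ 2 * a ^ 2 ≠ 0 := fun h0 => hne (by linarith)
  have hprod : (1 + Lta t a) * (1 - Lta t a) =
      (1 - t ^ 2 * a ^ 2) • (1 : Matrix (Fin 4) (Fin 4) ℝ) := by
    rw [sub_smul, one_smul, ← hsq]
    noncomm_ring
  rw [Matrix.mul_smul, hprod, smul_smul, one_div_mul_cancel hne', one_smul]

/-- The explicit form of the conjugate of `J₀` by `1 + L_t`. -/
lemma conj_J4_eq (t a : ℝ) (hne : t ^ 2 * a ^ 2 - 1 ≠ 0) :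
    (1 + Lta t a) * J4 * (1 + Lta t a)⁻¹ =
      (1 / (t ^ 2 * a ^ 2 - 1)) •
        !![0, 1 + t ^ 2 * a ^ 2, 0, 2 * t * a;
           -(1 + t ^ 2 * a ^ 2), 0, 2 * t * a, 0;
           0, 2 * t * a, 0, 1 + t ^ 2 * a ^ 2;
           2 * t * a, 0, -(1 + t ^ 2 * a ^ 2), 0] := by
  have hc : 1 / (1 - t ^ 2 * a ^ 2) = -(1 / (t ^ 2 * a ^ 2 - 1)) := by
    rw [← neg_sub, one_div, one_div, inv_neg]
  rw [Matrix.inv_eq_right_inv (one_add_Lta_mul_inverse t a hne), Matrix.mul_smul, hc,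
    neg_smul, ← smul_neg]
  congr 1
  ext i j
  fin_cases i <;> fin_cases j <;>
    simp [Lta, J4, Matrix.mul_apply, Fin.sum_univ_four, Matrix.one_apply] <;> ring

/-- `ω` in coordinates. -/
lemma omega4_eq (u v : Fin 4 → ℝ) :
    omega4 u v = u 0 * v 1 - u 1 * v 0 + (u 2 * v 3 - u 3 * v 2) := by
  simp [omega4, J4, Matrix.mulVec, dotProduct, Fin.sum_univ_four]
  ring

theorem statement16 (t a : ℝ) (h : 4 * t ^ 2 * a ^ 2 < 1) :
    IsUnit (1 + Lta t a) ∧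
    (1 + Lta t a) * J4 * (1 + Lta t a)⁻¹ =
      (1 / (t ^ 2 * a ^ 2 - 1)) •
        !![0, 1 + t ^ 2 * a ^ 2, 0, 2 * t * a;
           -(1 + t ^ 2 * a ^ 2), 0, 2 * t * a, 0;
           0, 2 * t * a, 0, 1 + t ^ 2 * a ^ 2;
           2 * t * a, 0, -(1 + t ^ 2 * a ^ 2), 0] ∧
    ((1 + Lta t a) * J4 * (1 + Lta t a)⁻¹) * ((1 + Lta t a) * J4 * (1 + Lta t a)⁻¹) = -1 ∧
    (∀ u v : Fin 4 → ℝ,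
      omega4 (((1 + Lta t a) * J4 * (1 + Lta t a)⁻¹) *ᵥ u)
          (((1 + Lta t a) * J4 * (1 + Lta t a)⁻¹) *ᵥ v) =
        omega4 u v) ∧
    (∀ v : Fin 4 → ℝ, v ≠ 0 →
      0 < omega4 v (((1 + Lta t a) * J4 * (1 + Lta t a)⁻¹) *ᵥ v)) := by
  have hlt : t ^ 2 * a ^ 2 < 1 / 4 := by linarith
  have hne : t ^ 2 * a ^ 2 - 1 ≠ 0 := fun h0 => by linarith
  have hunit : IsUnit (1 + Lta t a) :=
    (Matrix.isUnit_iff_isUnit_det _).2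
      (Matrix.isUnit_det_of_right_inverse (one_add_Lta_mul_inverse t a hne))
  have hmulVec : ∀ v : Fin 4 → ℝ, ((1 + Lta t a) * J4 * (1 + Lta t a)⁻¹) *ᵥ v =
      (1 / (t ^ 2 * a ^ 2 - 1)) •
        ![(1 + t ^ 2 * a ^ 2) * v 1 + 2 * t * a * v 3,
          -(1 + t ^ 2 * a ^ 2) * v 0 + 2 * t * a * v 2,
          2 * t * a * v 1 + (1 + t ^ 2 * a ^ 2) * v 3,
          2 * t * a * v 0 - (1 + t ^ 2 * a ^ 2) * v 2] := by
    intro v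
    rw [conj_J4_eq t a hne, Matrix.smul_mulVec]
    congr 1
    ext i
    fin_cases i <;> simp [Matrix.mulVec, dotProduct, Fin.sum_univ_four] <;> ring
  refine ⟨hunit, conj_J4_eq t a hne, ?_, ?_, ?_⟩
  · have hdet := (Matrix.isUnit_iff_isUnit_det _).1 hunit
    have hJ : J4 * J4 = -1 := by
      ext i j
      fin_cases i <;> fin_cases j <;> simp [J4, Matrix.mul_apply, Fin.sum_univ_four]
    calc _ = (1 + Lta t a) * J4 * ((1 + Lta t a)⁻¹ * (1 + Lta t a)) * J4 * (1 + Lta t a)⁻¹ := by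
          simp only [Matrix.mul_assoc]
      _ = (1 + Lta t a) * (J4 * J4) * (1 + Lta t a)⁻¹ := by
          rw [Matrix.nonsing_inv_mul _ hdet, Matrix.mul_one, Matrix.mul_assoc (1 + Lta t a)]
      _ = -1 := by
          rw [hJ, Matrix.mul_neg, Matrix.mul_one, Matrix.neg_mul, Matrix.mul_nonsing_inv _ hdet]
  · intro u v
    rw [hmulVec, hmulVec, omega4_eq, omega4_eq]
    simp
    field_simp
    ring
  · intro v hv
    have hpos : 0 < v 0 ^ 2 + v 1 ^ 2 + v 2 ^ 2 + v 3 ^ 2 := by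
      obtain ⟨i, hi⟩ := Function.ne_iff.1 hv
      have hi' : 0 < v i ^ 2 := sq_pos_iff.2 hi
      fin_cases i <;> simp at hi' <;> positivity
    have key : omega4 v (((1 + Lta t a) * J4 * (1 + Lta t a)⁻¹) *ᵥ v) =
        ((1 + t ^ 2 * a ^ 2) * (v 0 ^ 2 + v 1 ^ 2 + v 2 ^ 2 + v 3 ^ 2) +
          4 * (t * a) * (v 1 * v 3 - v 0 * v 2)) / (1 - t ^ 2 * a ^ 2) := by
      have hne' : 1 - t ^ 2 * a ^ 2 ≠ 0 := fun h0 => by linarith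
      rw [hmulVec, omega4_eq]
      simp
      field_simp
      ring
    rw [key]
    refine div_pos ?_ (by linarith)
    have hmul := mul_pos (show 0 < 1 / 2 - t ^ 2 * a ^ 2 by linarith) hpos
    linarith [sq_nonneg (v 1 + 2 * (t * a) * v 3), sq_nonneg (v 3 + 2 * (t * a) * v 1),
      sq_nonneg (v 0 - 2 * (t * a) * v 2), sq_nonneg (v 2 - 2 * (t * a) * v 0)]
end
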